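/- Let S(r, δ, α) = {z ∈ ℝ^d : (1−δ)r < |z| < r} ∩ {z : √(z₁² + ⋯ + z_{d−1}²) ≤ α z_d} be the intersection of an annulus with a cone around e_d. Then there exist constants c₁, c₂ > 0 depending only on d such that for all r > 0, δ ∈ (0, 1/2), α ∈ (0, 1), the Lebesgue measure satisfies c₁ r^d δ α^{d−1} ≤ vol(S(r, δ, α)) ≤ c₂ r^d δ α^{d−1}. -/

import Mathlib

open MeasureTheory
open scoped Pointwise

/-- The cone around the last coordinate direction. -/
def coneK (d : ℕ) (α : ℝ) : Set (EuclideanSpace ℝ (Fin (d+2))) :=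
  {z | Real.sqrt (∑ i : Fin (d+1), (z i.castSucc)^2) ≤ α * z (Fin.last (d+1))}

lemma coneK_closed (d : ℕ) (α : ℝ) : IsClosed (coneK d α) := by
  apply isClosed_le <;> fun_prop

lemma coneK_smul (d : ℕ) (α ρ : ℝ) (hρ : 0 < ρ) (z : EuclideanSpace ℝ (Fin (d+2)))
    (hz : z ∈ coneK d α) : ρ • z ∈ coneK d α := by
  simp only [coneK, Set.mem_ofPred_eq, PiLp.smul_apply, smul_eq_mul, mul_pow] at hz ⊢
  rw [← Finset.mul_sum, Real.sqrt_mul (sq_nonneg ρ), Real.sqrt_sq hρ.le]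
  nlinarith

lemma cone_ball_scale (d : ℕ) (α ρ : ℝ) (hρ : 0 < ρ) :
    volume.real (coneK d α ∩ Metric.ball 0 ρ)
      = ρ^(d+2) * volume.real (coneK d α ∩ Metric.ball 0 1) := by
  have h : coneK d α ∩ Metric.ball 0 ρ = ρ • (coneK d α ∩ Metric.ball 0 1) := by
    ext z
    rw [Set.mem_smul_set_iff_inv_smul_mem₀ hρ.ne']
    simp only [Set.mem_inter_iff, mem_ball_zero_iff, norm_smul, norm_inv, Real.norm_eq_abs,
      abs_of_pos hρ]
    have h2 : ρ⁻¹ * ‖z‖ < 1 ↔ ‖z‖ < ρ := by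
      rw [inv_mul_lt_iff₀ hρ, mul_one]
    rw [h2]
    refine and_congr_left fun _ => ⟨fun h => coneK_smul d α _ (inv_pos.2 hρ) z h, fun h => ?_⟩
    have := coneK_smul d α _ hρ _ h
    rwa [smul_inv_smul₀ hρ.ne'] at this
  rw [h, Measure.real, Measure.addHaar_smul, ENNReal.toReal_mul, ENNReal.toReal_ofReal (abs_nonneg _)]
  simp [abs_of_pos hρ, Measure.real]

lemma shell_vol (d : ℕ) (α r δ : ℝ) (hr : 0 < r) (h0 : 0 < δ) (h1 : δ < 1/2) :
    volume.real {z : EuclideanSpace ℝ (Fin (d+2)) |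
          (1-δ)*r < ‖z‖ ∧ ‖z‖ < r ∧
          Real.sqrt (∑ i : Fin (d+1), (z i.castSucc)^2) ≤
            α * z (Fin.last (d+1))} =
    r^(d+2) * (1 - (1-δ)^(d+2)) * volume.real (coneK d α ∩ Metric.ball 0 1) := by
  have hq : 0 < (1-δ)*r := mul_pos (by linarith) hr
  have hS : {z : EuclideanSpace ℝ (Fin (d+2)) |
          (1-δ)*r < ‖z‖ ∧ ‖z‖ < r ∧
          Real.sqrt (∑ i : Fin (d+1), (z i.castSucc)^2) ≤
            α * z (Fin.last (d+1))} =
      (coneK d α ∩ Metric.ball 0 r) \ (coneK d α ∩ Metric.closedBall 0 ((1-δ)*r)) := by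
    ext z
    simp only [coneK, Set.mem_ofPred_eq, Set.mem_sdiff, Set.mem_inter_iff, mem_ball_zero_iff,
      mem_closedBall_zero_iff, not_and, not_le]
    tauto
  have hcb : volume.real (coneK d α ∩ Metric.closedBall 0 ((1-δ)*r))
      = volume.real (coneK d α ∩ Metric.ball 0 ((1-δ)*r)) := by
    apply measureReal_congr
    refine (ae_eq_refl _).inter ?_
    rw [← Metric.ball_union_sphere]
    exact union_ae_eq_left_of_ae_eq_empty (ae_eq_empty.2 (Measure.addHaar_sphere _ _ _))
  rw [hS, measureReal_sdiff, hcb, cone_ball_scale d α r hr, cone_ball_scale d α _ hq, mul_pow]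
  · ring
  · refine Set.inter_subset_inter_right _ (Metric.closedBall_subset_ball ?_)
    nlinarith
  · exact ((coneK_closed d α).inter Metric.isClosed_closedBall).measurableSet

/-- A coordinate box. -/
def boxB (d : ℕ) (a b c : ℝ) : Set (EuclideanSpace ℝ (Fin (d+2))) :=
  {z | (∀ i : Fin (d+1), z i.castSucc ∈ Set.Icc (-a) a) ∧ z (Fin.last (d+1)) ∈ Set.Icc b c}

lemma boxB_vol (d : ℕ) (a b c : ℝ) :
    volume (boxB d a b c) = ENNReal.ofReal (2*a)^(d+1) * ENNReal.ofReal (c-b) := by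
  have h : boxB d a b c = (WithLp.ofLp : EuclideanSpace ℝ (Fin (d+2)) → _) ⁻¹'
      Set.univ.pi (Fin.snoc (α := fun _ => Set ℝ) (fun _ : Fin (d+1) => Set.Icc (-a) a)
        (Set.Icc b c)) := by
    ext z
    simp only [boxB, Set.mem_ofPred_eq, Set.mem_preimage, Set.mem_univ_pi]
    constructor
    · rintro ⟨h1, h2⟩ i
      refine Fin.lastCases ?_ (fun j => ?_) i
      · rw [Fin.snoc_last]; exact h2
      · rw [Fin.snoc_castSucc]; exact h1 j
    · intro h
      refine ⟨fun j => ?_, ?_⟩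
      · have := h j.castSucc
        rwa [Fin.snoc_castSucc] at this
      · have := h (Fin.last (d+1))
        rwa [Fin.snoc_last] at this
  rw [h, (PiLp.volume_preserving_ofLp (Fin (d+2))).measure_preimage_emb
    (MeasurableEquiv.toLp 2 (Fin (d+2) → ℝ)).symm.measurableEmbedding, volume_pi_pi,
    Fin.prod_univ_castSucc]
  · simp [Real.volume_Icc, two_mul]

lemma cone_upper (d : ℕ) (α : ℝ) (h0 : 0 < α) :
    volume.real (coneK d α ∩ Metric.ball 0 1) ≤ 2^(d+1) * α^(d+1) := by
  have hs : coneK d α ∩ Metric.ball 0 1 ⊆ boxB d α 0 1 := by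
    rintro z ⟨hz, hb⟩
    simp only [coneK, Set.mem_ofPred_eq] at hz
    rw [mem_ball_zero_iff] at hb
    have hl : z (Fin.last (d+1)) ≤ 1 :=
      (le_abs_self _).trans ((PiLp.norm_apply_le z _).trans hb.le)
    have hp : 0 ≤ α * z (Fin.last (d+1)) := (Real.sqrt_nonneg _).trans hz
    refine ⟨fun i => ?_, nonneg_of_mul_nonneg_right hp h0, hl⟩
    rw [Set.mem_Icc, ← abs_le]
    calc |z i.castSucc| ≤ Real.sqrt (∑ i : Fin (d+1), (z i.castSucc)^2) := by
          apply Real.abs_le_sqrt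
          exact Finset.single_le_sum (f := fun i : Fin (d+1) => (z i.castSucc)^2)
            (fun i _ => sq_nonneg _) (Finset.mem_univ i)
      _ ≤ α := hz.trans (by nlinarith)
  have hv := boxB_vol d α 0 1
  calc _ ≤ volume.real (boxB d α 0 1) := by
        refine measureReal_mono hs ?_
        rw [hv]
        finiteness
    _ = _ := by
        rw [Measure.real, hv, ← mul_pow]
        simp [h0.le]

lemma cone_lower (d : ℕ) (α : ℝ) (h0 : 0 < α) (h1 : α < 1) :
    (1 / (2 * (d+1)))^(d+1) / 4 * α^(d+1) ≤ volume.real (coneK d α ∩ Metric.ball 0 1) := by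
  set a : ℝ := α / (4 * (d+1)) with ha
  have hd : (0:ℝ) < d + 1 := by positivity
  have ha0 : 0 < a := by positivity
  have hs : boxB d a (1/4) (1/2) ⊆ coneK d α ∩ Metric.ball 0 1 := by
    rintro z ⟨hz, hb1, hb2⟩
    have hsum : ∑ i : Fin (d+1), (z i.castSucc)^2 ≤ (α/4)^2 := by
      calc _ ≤ ∑ i : Fin (d+1), a^2 := by
            refine Finset.sum_le_sum fun i _ => ?_
            exact sq_le_sq' (hz i).1 (hz i).2
        _ = (d+1) * a^2 := by simp
        _ ≤ ((d+1) * a)^2 := by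
            rw [mul_pow]
            have : (1:ℝ) ≤ d + 1 := by simp
            nlinarith [mul_nonneg (mul_nonneg hd.le (sub_nonneg.2 this)) (sq_nonneg a)]
        _ = (α/4)^2 := by rw [ha]; field_simp
    constructor
    · simp only [coneK, Set.mem_ofPred_eq]
      calc _ ≤ α / 4 := Real.sqrt_le_iff.2 ⟨by positivity, hsum⟩
        _ ≤ _ := by nlinarith
    · rw [mem_ball_zero_iff, EuclideanSpace.norm_eq, Real.sqrt_lt' one_pos,
        Fin.sum_univ_castSucc]
      simp only [Real.norm_eq_abs, sq_abs]
      nlinarith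
  have hv := boxB_vol d a (1/4) (1/2)
  calc _ = volume.real (boxB d a (1/4) (1/2)) := by
        rw [Measure.real, hv, ENNReal.toReal_mul, ENNReal.toReal_pow,
          ENNReal.toReal_ofReal (by positivity), ENNReal.toReal_ofReal (by norm_num)]
        have : 2 * a = (1 / (2 * (d+1))) * α := by rw [ha]; field_simp; norm_num
        rw [this, mul_pow]; ring
    _ ≤ _ := by
        refine measureReal_mono hs ?_
        exact measure_ne_top_of_subset Set.inter_subset_right measure_ball_lt_top.ne

/-- The Lebesgue measure of the annulus–cone intersection
`S(r,δ,α) = {z : (1−δ)r < |z| < r} ∩ {z : √(z₁²+⋯+z_{d−1}²) ≤ α z_d}`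
is comparable to `r^d δ α^{d−1}` with constants depending only on the
dimension (here the dimension is `d + 2 ≥ 2`). -/
theorem stmt_12 (d : ℕ) :
    ∃ c₁ > (0:ℝ), ∃ c₂ > (0:ℝ), ∀ r δ α : ℝ,
      0 < r → δ ∈ Set.Ioo (0:ℝ) (1/2) → α ∈ Set.Ioo (0:ℝ) 1 →
      c₁ * r^(d+2) * δ * α^(d+1) ≤
        (volume {z : EuclideanSpace ℝ (Fin (d+2)) |
          (1-δ)*r < ‖z‖ ∧ ‖z‖ < r ∧
          Real.sqrt (∑ i : Fin (d+1), (z i.castSucc)^2) ≤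
            α * z (Fin.last (d+1))}).toReal ∧
      (volume {z : EuclideanSpace ℝ (Fin (d+2)) |
          (1-δ)*r < ‖z‖ ∧ ‖z‖ < r ∧
          Real.sqrt (∑ i : Fin (d+1), (z i.castSucc)^2) ≤
            α * z (Fin.last (d+1))}).toReal ≤ c₂ * r^(d+2) * δ * α^(d+1) := by
  refine ⟨(1 / (2 * (d+1)))^(d+1) / 4, by positivity, (d+2) * 2^(d+1), by positivity, ?_⟩
  rintro r δ α hr ⟨hδ0, hδ1⟩ ⟨hα0, hα1⟩
  have hS := shell_vol d α r δ hr hδ0 hδ1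
  rw [Measure.real] at hS
  rw [hS]
  have hl : δ ≤ 1 - (1-δ)^(d+2) := by
    have := pow_le_of_le_one (by linarith : 0 ≤ 1 - δ) (by linarith) (by omega : d+2 ≠ 0)
    linarith
  have hu : 1 - (1-δ)^(d+2) ≤ (d+2) * δ := by
    have := one_add_mul_le_pow (by linarith : -2 ≤ -δ) (d+2)
    push_cast at this
    rw [← sub_eq_add_neg] at this
    linarith
  have hlow := cone_lower d α hα0 hα1
  have hup := cone_upper d α hα0
  have hpos : 0 ≤ 1 - (1-δ)^(d+2) := hδ0.le.trans hl
  constructor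
  · calc _ = r^(d+2) * δ * ((1 / (2 * (d+1)))^(d+1) / 4 * α^(d+1)) := by ring
      _ ≤ _ := by gcongr
  · calc _ ≤ r^(d+2) * ((d+2) * δ) * (2^(d+1) * α^(d+1)) := by
          gcongr
      _ = _ := by ring
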